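/- arXiv:1804.00108 — 5 statements merged into one kernel-verified Lean document; each statement's English description precedes it below -/
import Mathlib

section
/- Let d ≥ 2, N ≥ 1 and m ≥ 1. For any sample S = (ω₁,…,ω_m) of indices in [N]^d, the empirical Rademacher complexity of the unit M-norm ball satisfies (2/m) · E_ε [ sup_{T : ‖T‖_M ≤ 1} | Σ_{i=1}^m ε_i T(ω_i) | ] < 6 √(dN/m), where ε = (ε₁,…,ε_m) is uniformly distributed on {±1}^m. -/
open scoped BigOperators
open Classical MeasureTheory Pointwise

noncomputable section

/-- An index of an order-`d` tensor of size `N`. -/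
abbrev TIndex (N d : ℕ) := Fin d → Fin N

/-- The infinity norm of a tensor: the supremum of absolute values of its entries. -/
def infNorm {N d : ℕ} (T : TIndex N d → ℝ) : ℝ :=
  sSup (Set.range fun ω => |T ω|)

/-- The squared Frobenius norm of a tensor. -/
def frobSq {N d : ℕ} (T : TIndex N d → ℝ) : ℝ := ∑ ω : TIndex N d, (T ω) ^ 2

/-- The maximum ℓ₂-row-norm ‖U‖_{2,∞} of a matrix `U`. -/
def rowNorm {N k : ℕ} (U : Fin N → Fin k → ℝ) : ℝ :=
  sSup (Set.range fun i => Real.sqrt (∑ c, (U i c) ^ 2))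

/-- The max-qnorm of a tensor: infimum over all factorizations (with factor matrices
having any finite number `k` of columns) of the product of the row norms. -/
def maxQnorm {N d : ℕ} (T : TIndex N d → ℝ) : ℝ :=
  sInf {t : ℝ | ∃ (k : ℕ) (U : Fin d → Fin N → Fin k → ℝ),
    (∀ ω : TIndex N d, T ω = ∑ c : Fin k, ∏ j : Fin d, U j (ω j) c) ∧
    t = ∏ j : Fin d, rowNorm (U j)}

/-- The rank-one sign tensors `T_±`. -/
def signTensors (N d : ℕ) : Set (TIndex N d → ℝ) :=
  {T | ∃ u : Fin d → Fin N → ℝ, (∀ j i, u j i = 1 ∨ u j i = -1) ∧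
    ∀ ω : TIndex N d, T ω = ∏ j : Fin d, u j (ω j)}

/-- The atomic M-norm of a tensor. -/
def Mnorm {N d : ℕ} (T : TIndex N d → ℝ) : ℝ :=
  sInf {t : ℝ | 0 < t ∧ T ∈ t • convexHull ℝ (signTensors N d)}

/-- The constraint set for max-qnorm constrained estimation. -/
def Kmax (N d : ℕ) (α R : ℝ) : Set (TIndex N d → ℝ) :=
  {X | infNorm X ≤ α ∧ maxQnorm X ≤ R}

/-- The constraint set for M-norm constrained estimation. -/
def KM (N d : ℕ) (α R : ℝ) : Set (TIndex N d → ℝ) :=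
  {X | infNorm X ≤ α ∧ Mnorm X ≤ R}

/-- The set of values whose supremum is `L_α`. -/
def Lset (f : ℝ → ℝ) (α : ℝ) : Set ℝ :=
  (fun x => |deriv f x| / (f x * (1 - f x))) '' {x : ℝ | |x| ≤ α}

/-- The steepness constant `L_α`. -/
def Lconst (f : ℝ → ℝ) (α : ℝ) : ℝ := sSup (Lset f α)

/-- The set of values whose supremum is `β_α`. -/
def βset (f : ℝ → ℝ) (α : ℝ) : Set ℝ :=
  (fun x => f x * (1 - f x) / (deriv f x) ^ 2) '' {x : ℝ | |x| ≤ α}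

/-- The flatness constant `β_α`. -/
def βconst (f : ℝ → ℝ) (α : ℝ) : ℝ := sSup (βset f α)

/-- The set of values whose supremum is `U_α`. -/
def Uset (f : ℝ → ℝ) (α : ℝ) : Set ℝ :=
  (fun x => Real.log (1 / (f x * (1 - f x)))) '' {x : ℝ | |x| ≤ α}

/-- The constant `U_α`. -/
def Uconst (f : ℝ → ℝ) (α : ℝ) : ℝ := sSup (Uset f α)

/-- The 1-bit loss `g(x; y)`; `y : Bool` encodes `+1` as `true` and `-1` as `false`. -/
def loss (f : ℝ → ℝ) (x : ℝ) (y : Bool) : ℝ :=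
  if y then Real.log (1 / f x) else Real.log (1 / (1 - f x))

/-- The negative log-likelihood of a tensor `X` given data `D` (sampled indices with
their 1-bit observations). -/
def negLogLik (f : ℝ → ℝ) {N d m : ℕ} (D : Fin m → TIndex N d × Bool)
    (X : TIndex N d → ℝ) : ℝ :=
  ∑ i, loss f (X (D i).1) (D i).2

/-- Probability of observing the data `D` when indices are drawn i.i.d. from `π` and
observations are generated from the true tensor `T` via the link function `f`. -/
def dataProb (f : ℝ → ℝ) {N d m : ℕ} (π : TIndex N d → ℝ)
    (T : TIndex N d → ℝ) (D : Fin m → TIndex N d × Bool) : ℝ :=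
  ∏ i, π (D i).1 * (if (D i).2 then f (T (D i).1) else 1 - f (T (D i).1))

/-- Probability of an event `E` on the data, under the sampling/observation model. -/
def eventProb (f : ℝ → ℝ) {N d : ℕ} (m : ℕ) (π : TIndex N d → ℝ)
    (T : TIndex N d → ℝ) (E : (Fin m → TIndex N d × Bool) → Prop) : ℝ :=
  ∑ D : Fin m → TIndex N d × Bool, if E D then dataProb f π T D else 0

/-- The weighted squared norm ‖T‖_Π². -/
def PiNormSq {N d : ℕ} (π : TIndex N d → ℝ) (T : TIndex N d → ℝ) : ℝ :=
  ∑ ω : TIndex N d, π ω * (T ω) ^ 2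

/-- `π` is a probability distribution on the index set. -/
def IsProbDist {N d : ℕ} (π : TIndex N d → ℝ) : Prop :=
  (∀ ω, 0 ≤ π ω) ∧ ∑ ω : TIndex N d, π ω = 1

/-- A tensor has rank at most `r`: it is a sum of `r` outer products of vectors. -/
def HasRankAtMost {N d : ℕ} (T : TIndex N d → ℝ) (r : ℕ) : Prop :=
  ∃ u : Fin r → Fin d → Fin N → ℝ,
    ∀ ω : TIndex N d, T ω = ∑ i : Fin r, ∏ j : Fin d, u i j (ω j)

/-- The empirical average loss `D_S(X; Y)` over a sample `S`. -/
def DS (f : ℝ → ℝ) {N d m : ℕ} (S : Fin m → TIndex N d) (Y : TIndex N d → Bool)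
    (X : TIndex N d → ℝ) : ℝ :=
  (1 / (m : ℝ)) * ∑ i, loss f (X (S i)) (Y (S i))

/-- The `Π`-weighted average loss `D_Π(X; Y)`. -/
def DPi (f : ℝ → ℝ) {N d : ℕ} (π : TIndex N d → ℝ) (Y : TIndex N d → Bool)
    (X : TIndex N d → ℝ) : ℝ :=
  ∑ ω : TIndex N d, π ω * loss f (X ω) (Y ω)

/-- The scalar Kullback–Leibler divergence `KL(p ‖ q)`. -/
def KLdiv (p q : ℝ) : ℝ :=
  p * Real.log (p / q) + (1 - p) * Real.log ((1 - p) / (1 - q))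

/-- The expected 1-bit loss `Ē(x; p)` when the observation is `+1` with probability `p`. -/
def Ebar (f : ℝ → ℝ) (x p : ℝ) : ℝ :=
  p * loss f x true + (1 - p) * loss f x false

/-- The logistic function. -/
def logistic (x : ℝ) : ℝ := Real.exp x / (1 + Real.exp x)

/-- The standard Gaussian cumulative distribution function `Φ`. -/
def stdGaussianCDF (t : ℝ) : ℝ :=
  ∫ s in Set.Iic t, Real.exp (-s ^ 2 / 2) / Real.sqrt (2 * Real.pi)


theorem exists_pos_mem_smul_convexHull_of_mem_span {E : Type*} [AddCommGroup E] [Module ℝ E]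
    {s : Set E} (hneg : -s = s) (hne : s.Nonempty) {x : E} (hx : x ∈ Submodule.span ℝ s) :
    ∃ t : ℝ, 0 < t ∧ x ∈ t • convexHull ℝ s := by
  have hconv : Convex ℝ (convexHull ℝ s) := convex_convexHull ℝ s
  have hneg' : ∀ y ∈ convexHull ℝ s, -y ∈ convexHull ℝ s := fun y hy => by
    rw [← hneg, convexHull_neg]
    simpa using hy
  have hzero : (0 : E) ∈ convexHull ℝ s := by
    obtain ⟨y, hy⟩ := hne
    have hy' := subset_convexHull ℝ s hy
    simpa using hconv hy' (hneg' y hy') (by norm_num : (0 : ℝ) ≤ 1 / 2)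
      (by norm_num : (0 : ℝ) ≤ 1 / 2) (by norm_num)
  induction hx using Submodule.span_induction with
  | mem y hy => exact ⟨1, one_pos, by simpa using subset_convexHull ℝ s hy⟩
  | zero => exact ⟨1, one_pos, by simpa using hzero⟩
  | add y z _ _ hy hz =>
    obtain ⟨p, hp, hy⟩ := hy
    obtain ⟨q, hq, hz⟩ := hz
    exact ⟨p + q, add_pos hp hq, by
      rw [hconv.add_smul hp.le hq.le]
      exact Set.add_mem_add hy hz⟩
  | smul a y _ hy =>
    obtain ⟨t, ht, y, hy, rfl⟩ := hy
    rcases lt_trichotomy a 0 with ha | rfl | ha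
    · exact ⟨-a * t, mul_pos (neg_pos.2 ha) ht, -y, hneg' y hy, by simp [mul_smul]⟩
    · exact ⟨1, one_pos, by simpa using hzero⟩
    · exact ⟨a * t, mul_pos ha ht, y, hy, by simp [mul_smul]⟩

theorem neg_signTensors {N d : ℕ} (hd : 1 ≤ d) : -signTensors N d = signTensors N d := by
  have key : ∀ T ∈ signTensors N d, -T ∈ signTensors N d := by
    rintro T ⟨u, hu, hT⟩
    refine ⟨fun j i => if j = ⟨0, hd⟩ then -u j i else u j i, fun j i => ?_, fun ω => ?_⟩
    · dsimp only
      split_ifs <;> rcases hu j i with h | h <;> simp [h]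
    · have h : ∀ j, (if j = ⟨0, hd⟩ then -u j (ω j) else u j (ω j)) =
          (if j = ⟨0, hd⟩ then -1 else 1) * u j (ω j) := fun j => by split_ifs <;> simp
      simp only [h, Finset.prod_mul_distrib, Finset.prod_ite_eq', Finset.mem_univ, if_true,
        Pi.neg_apply, hT, neg_one_mul]
  ext T
  exact ⟨fun h => by simpa using key _ h, fun h => key T h⟩

theorem signTensors_nonempty (N d : ℕ) : (signTensors N d).Nonempty :=
  ⟨fun _ => 1, fun _ _ => 1, by simp, by simp⟩

theorem span_signTensors (N d : ℕ) : Submodule.span ℝ (signTensors N d) = ⊤ := by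
  have hsingle : ∀ τ : TIndex N d,
      (Pi.single τ 1 : TIndex N d → ℝ) ∈ Submodule.span ℝ (signTensors N d) := by
    intro τ
    let s : Fin d → Fin N → ℝ := fun j i => if i = τ j then 1 else -1
    have hs : (Pi.single τ 1 : TIndex N d → ℝ) =
        ((1 / 2 : ℝ) ^ d) • ∑ A ∈ (Finset.univ : Finset (Fin d)).powerset,
          fun ω => ∏ j ∈ A, s j (ω j) := by
      funext ω
      simp only [Pi.smul_apply, Finset.sum_apply, smul_eq_mul]
      rw [← Finset.prod_one_add]
      have hpow : (1 / 2 : ℝ) ^ d = ∏ _j : Fin d, (1 / 2 : ℝ) := by simp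
      rw [hpow, ← Finset.prod_mul_distrib]
      have hfac : ∀ j, (1 / 2 : ℝ) * (1 + s j (ω j)) = if ω j = τ j then 1 else 0 := by
        intro j
        by_cases h : ω j = τ j <;> simp [s, h]
        norm_num
      simp only [hfac, Finset.prod_ite_zero, Finset.prod_const_one, Pi.single_apply, funext_iff,
        Finset.mem_univ, true_imp_iff]
    rw [hs]
    refine Submodule.smul_mem _ _ (Submodule.sum_mem _ fun A _ => Submodule.subset_span ?_)
    refine ⟨fun j i => if j ∈ A then s j i else 1, fun j i => ?_, fun ω => ?_⟩
    · by_cases hA : j ∈ A <;> by_cases hi : i = τ j <;> simp [s, hA, hi]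
    · simp [Finset.prod_ite_mem]
  refine eq_top_iff.2 fun T _ => ?_
  rw [pi_eq_sum_univ' T]
  refine Submodule.sum_mem _ fun τ _ => Submodule.smul_mem _ _ ?_
  convert hsingle τ using 1

/-- A linear functional bounded on the sign tensors obeys the same bound on the unit M-norm ball. -/
theorem abs_apply_le_of_Mnorm_le_one {N d : ℕ} (hd : 1 ≤ d) (L : (TIndex N d → ℝ) →ₗ[ℝ] ℝ)
    {B : ℝ} (hB : ∀ T ∈ signTensors N d, |L T| ≤ B) {T : TIndex N d → ℝ} (hT : Mnorm T ≤ 1) :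
    |L T| ≤ B := by
  have hB0 : 0 ≤ B := by
    obtain ⟨T, hT⟩ := signTensors_nonempty N d
    exact (abs_nonneg _).trans (hB T hT)
  have hhull : ∀ T ∈ convexHull ℝ (signTensors N d), |L T| ≤ B := by
    have hsub : convexHull ℝ (signTensors N d) ⊆ L ⁻¹' Set.Icc (-B) B :=
      convexHull_min (fun T hT => abs_le.1 (hB T hT))
        ((convex_Icc (-B) B).is_linear_preimage L.isLinear)
    exact fun T hT => abs_le.2 (hsub hT)
  have hne : {t : ℝ | 0 < t ∧ T ∈ t • convexHull ℝ (signTensors N d)}.Nonempty :=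
    exists_pos_mem_smul_convexHull_of_mem_span (neg_signTensors hd) (signTensors_nonempty N d)
      (by simp [span_signTensors])
  have hlt : ∀ t : ℝ, 1 < t → |L T| ≤ t * B := by
    intro t ht
    obtain ⟨r, ⟨hr, Y, hY, rfl⟩, hrt⟩ := exists_lt_of_csInf_lt hne (hT.trans_lt ht)
    simp only [map_smul, smul_eq_mul, abs_mul, abs_of_pos hr]
    exact mul_le_mul hrt.le (hhull Y hY) (abs_nonneg _) (by linarith)
  refine le_of_forall_pos_le_add fun δ hδ => ?_
  have h := hlt (1 + δ / (B + 1)) (by linarith [div_pos hδ (by linarith : 0 < B + 1)])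
  have h' : δ / (B + 1) * B ≤ δ := by
    rw [div_mul_eq_mul_div, div_le_iff₀ (by linarith)]
    nlinarith
  linarith

theorem sum_exp_rademacher_le {m : ℕ} (a : Fin m → ℝ) :
    ∑ ε : Fin m → Bool, Real.exp (∑ i, (if ε i then (1 : ℝ) else -1) * a i) ≤
      2 ^ m * Real.exp ((∑ i, a i ^ 2) / 2) := by
  have hprod : ∑ ε : Fin m → Bool, Real.exp (∑ i, (if ε i then (1 : ℝ) else -1) * a i) =
      ∏ i, 2 * Real.cosh (a i) := by
    simp only [Real.exp_sum]
    rw [← Fintype.prod_sum (fun i (b : Bool) => Real.exp ((if b then (1 : ℝ) else -1) * a i))]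
    refine Finset.prod_congr rfl fun i _ => ?_
    simp [Real.cosh_eq]
    ring
  rw [hprod, Finset.prod_mul_distrib, Finset.sum_div, Real.exp_sum]
  simp only [Finset.prod_const, Finset.card_univ, Fintype.card_fin]
  gcongr with i
  exact Real.cosh_le_exp_half_sq _

theorem le_div_sub_one_add_log_of_exp_le {x y K : ℝ} (hK : 0 < K) (h : Real.exp x ≤ y) :
    x ≤ y / K - 1 + Real.log K := by
  have hexp : Real.exp (x - Real.log K) ≤ y / K := by
    rw [Real.exp_sub, Real.exp_log hK]
    gcongr
  linarith [Real.add_one_le_exp (x - Real.log K)]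

/-- The finite-class lemma for Rademacher averages, with a free parameter `t`. -/
theorem rademacher_average_le {m : ℕ} {ι : Type*} [Fintype ι] [Nonempty ι] (a : ι → Fin m → ℝ)
    (ha : ∀ σ i, a σ i ^ 2 ≤ 1) {t : ℝ} (F : (Fin m → Bool) → ℝ)
    (hF : ∀ ε, ∀ B : ℝ, (∀ σ, |∑ i, (if ε i then (1 : ℝ) else -1) * a σ i| ≤ B) → F ε ≤ B)
    (ht : 0 < t) :
    t * ((∑ ε, F ε) / 2 ^ m) ≤ Real.log (2 * Fintype.card ι) + m * t ^ 2 / 2 := by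
  set X : ι → (Fin m → Bool) → ℝ := fun σ ε => ∑ i, (if ε i then (1 : ℝ) else -1) * (t * a σ i)
    with hX
  set G : (Fin m → Bool) → ℝ := fun ε => ∑ σ, (Real.exp (X σ ε) + Real.exp (-X σ ε)) with hG
  set K : ℝ := 2 * Fintype.card ι * Real.exp (m * t ^ 2 / 2) with hKdef
  have hcard : (0 : ℝ) < Fintype.card ι := by exact_mod_cast Fintype.card_pos
  have hK : 0 < K := by positivity
  have hlogK : Real.log K = Real.log (2 * Fintype.card ι) + m * t ^ 2 / 2 := by
    rw [hKdef, Real.log_mul (by positivity) (by positivity), Real.log_exp]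
  have hmgf : ∀ b : Fin m → ℝ, (∀ i, b i ^ 2 ≤ t ^ 2) →
      ∑ ε : Fin m → Bool, Real.exp (∑ i, (if ε i then (1 : ℝ) else -1) * b i) ≤
        2 ^ m * Real.exp (m * t ^ 2 / 2) := by
    intro b hb
    refine (sum_exp_rademacher_le b).trans ?_
    gcongr
    simpa using Finset.sum_le_sum fun i (_ : i ∈ Finset.univ) => hb i
  have hsq : ∀ σ i, (t * a σ i) ^ 2 ≤ t ^ 2 := fun σ i => by
    nlinarith [ha σ i, sq_nonneg t]
  have hsumG : ∑ ε, G ε ≤ 2 ^ m * K := by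
    rw [hG, Finset.sum_comm]
    have hσ : ∀ σ, ∑ ε, (Real.exp (X σ ε) + Real.exp (-X σ ε)) ≤
        2 * (2 ^ m * Real.exp (m * t ^ 2 / 2)) := by
      intro σ
      rw [Finset.sum_add_distrib, two_mul]
      refine add_le_add (hmgf _ (hsq σ)) ?_
      have h := hmgf (fun i => -(t * a σ i)) (fun i => by simpa using hsq σ i)
      simpa [hX, Finset.sum_neg_distrib] using h
    refine (Finset.sum_le_sum fun σ _ => hσ σ).trans_eq ?_
    simp [hKdef]
    ring
  have hFε : ∀ ε, t * F ε ≤ G ε / K - 1 + Real.log K := by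
    intro ε
    rw [mul_comm, ← le_div_iff₀ ht]
    refine hF ε _ fun σ => ?_
    rw [le_div_iff₀ ht]
    have hXσ : |∑ i, (if ε i then (1 : ℝ) else -1) * a σ i| * t = |X σ ε| := by
      have habs := abs_mul (∑ i, (if ε i then (1 : ℝ) else -1) * a σ i) t
      rw [abs_of_pos ht, Finset.sum_mul] at habs
      rw [← habs]
      congr 1
      exact Finset.sum_congr rfl fun i _ => by ring
    rw [hXσ]
    refine le_div_sub_one_add_log_of_exp_le hK ((?_ : _ ≤ _).trans
      (Finset.single_le_sum (f := fun σ => Real.exp (X σ ε) + Real.exp (-X σ ε))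
        (fun σ _ => by positivity) (Finset.mem_univ σ)))
    rcases abs_choice (X σ ε) with h | h <;> rw [h]
    · linarith [Real.exp_pos (-X σ ε)]
    · linarith [Real.exp_pos (X σ ε)]
  have hsum : t * ∑ ε, F ε ≤ 2 ^ m * Real.log K := by
    rw [Finset.mul_sum]
    refine (Finset.sum_le_sum fun ε _ => hFε ε).trans ?_
    rw [Finset.sum_add_distrib, Finset.sum_sub_distrib, ← Finset.sum_div]
    have hdiv : (∑ ε, G ε) / K ≤ 2 ^ m := (div_le_iff₀ hK).2 hsumG
    simp
    linarith
  rw [← hlogK, ← mul_div_assoc, div_le_iff₀ (by positivity)]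
  linarith

/-- Rademacher complexity bound for the unit M-norm ball. -/
theorem rademacher_Mnorm_ball (N d m : ℕ) (hd : 2 ≤ d) (hN : 1 ≤ N)
    (hm : 1 ≤ m) (S : Fin m → TIndex N d) :
    (2 / (m : ℝ)) *
        ((∑ ε : Fin m → Bool,
          sSup {v : ℝ | ∃ T : TIndex N d → ℝ, Mnorm T ≤ 1 ∧
            v = |∑ i, (if ε i then (1 : ℝ) else -1) * T (S i)|}) / 2 ^ m) <
      6 * Real.sqrt ((d : ℝ) * N / m) := by
  have hm0 : (0 : ℝ) < m := by exact_mod_cast hm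
  have hn : (2 : ℝ) ≤ (d : ℝ) * N := by exact_mod_cast Nat.mul_le_mul hd hN
  set t : ℝ := Real.sqrt ((d : ℝ) * N / m) with ht
  have ht0 : 0 < t := Real.sqrt_pos.2 (by positivity)
  have ht2 : m * t ^ 2 = (d : ℝ) * N := by
    rw [ht, Real.sq_sqrt (by positivity)]
    field_simp
  let a : (Fin d → Fin N → Bool) → Fin m → ℝ :=
    fun σ i => ∏ j, (if σ j (S i j) then (1 : ℝ) else -1)
  have ha : ∀ σ i, a σ i ^ 2 ≤ 1 := fun σ i => by
    simp only [a, ← Finset.prod_pow, ite_pow, one_pow, even_two.neg_pow, ite_self,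
      Finset.prod_const_one, le_refl]
  have hF := rademacher_average_le a ha (t := t)
    (fun ε => sSup {v : ℝ | ∃ T : TIndex N d → ℝ, Mnorm T ≤ 1 ∧
      v = |∑ i, (if ε i then (1 : ℝ) else -1) * T (S i)|}) (by
    intro ε B hB
    refine Real.sSup_le ?_ ((abs_nonneg _).trans (hB fun _ _ => true))
    rintro v ⟨T, hT, rfl⟩
    let L : (TIndex N d → ℝ) →ₗ[ℝ] ℝ :=
      ∑ i, (if ε i then (1 : ℝ) else -1) • LinearMap.proj (S i)
    have hL : ∀ T, L T = ∑ i, (if ε i then (1 : ℝ) else -1) * T (S i) := fun T => by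
      simp only [L, LinearMap.sum_apply, LinearMap.smul_apply, LinearMap.proj_apply, smul_eq_mul]
    rw [← hL]
    refine abs_apply_le_of_Mnorm_le_one (by lia) L ?_ hT
    rintro Y ⟨u, hu, hY⟩
    rw [hL]
    have hu' : ∀ j i, (if decide (u j i = 1) = true then (1 : ℝ) else -1) = u j i := by
      intro j i
      rcases hu j i with h | h <;> rw [h] <;> norm_num
    have h := hB fun j i => decide (u j i = 1)
    simp only [a, hu'] at h
    simpa only [hY] using h) ht0
  have hlog : Real.log (2 * Fintype.card (Fin d → Fin N → Bool)) ≤ 3 / 2 * ((d : ℝ) * N) := by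
    have hc : (2 * Fintype.card (Fin d → Fin N → Bool) : ℝ) = 2 ^ (d * N + 1) := by
      simp [pow_succ, mul_comm, pow_mul]
    rw [hc, Real.log_pow]
    push_cast
    nlinarith [Real.log_two_lt_d9, Real.log_two_gt_d9]
  rw [ht2] at hF
  have hE := hF.trans (show _ ≤ t * (2 * (m * t)) by nlinarith)
  have hE' := le_of_mul_le_mul_left hE ht0
  calc _ ≤ 2 / (m : ℝ) * (2 * (m * t)) := by gcongr
    _ = 4 * t := by field_simp; norm_num
    _ < 6 * t := by linarith

end
end

section
/- There exists a constant K_G with 1 ≤ K_G < 1.8 (the Grothendieck constant) such that the following holds. Let d ≥ 2, N ≥ 1, α > 0, let r ≥ 1 be an integer, and let γ ∈ (0,1] be such that r/γ² is an integer and r/γ² ≤ N. Then there exists a finite set χ of order-d tensors of size N with: (1) |χ| ≥ exp( rN/(16γ²) ); (2) every T ∈ χ satisfies |T(ω)| = αγ for all ω ∈ [N]^d and ‖T‖_M ≤ K_G · α · √r; and (3) any two distinct T, T' ∈ χ satisfy ‖T − T'‖_F² ≥ α²γ² N^d / 2. -/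
open scoped BigOperators
open Classical MeasureTheory Pointwise

noncomputable section

/-- The sign `±1` encoded by a Boolean. -/
def boolSign (b : Bool) : ℝ := if b then 1 else -1

/-- The sign of a real number, with the convention that the sign of `0` is `1`. -/
def realSign (x : ℝ) : ℝ := if 0 ≤ x then 1 else -1

lemma boolSign_eq_or (b : Bool) : boolSign b = 1 ∨ boolSign b = -1 := by
  cases b <;> simp [boolSign]

lemma abs_boolSign (b : Bool) : |boolSign b| = 1 := by
  cases b <;> simp [boolSign]

lemma boolSign_beq (a b : Bool) : boolSign (a == b) = boolSign a * boolSign b := by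
  cases a <;> cases b <;> simp [boolSign]

lemma boolSign_mul_self (b : Bool) : boolSign b * boolSign b = 1 := by
  cases b <;> simp [boolSign]

lemma sq_boolSign_sub (a b : Bool) :
    (boolSign a - boolSign b) ^ 2 = 4 * if a ≠ b then 1 else 0 := by
  cases a <;> cases b <;> norm_num [boolSign]

lemma realSign_eq_or (x : ℝ) : realSign x = 1 ∨ realSign x = -1 := by
  unfold realSign; split_ifs <;> simp

lemma realSign_mul_self_eq_abs (x : ℝ) : realSign x * x = |x| := by
  unfold realSign
  split_ifs with h
  · rw [abs_of_nonneg h, one_mul]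
  · rw [abs_of_neg (not_le.mp h), neg_one_mul]

/-- The sum of the signs encoded by a Boolean vector. -/
def signSum {k : ℕ} (ε : Fin k → Bool) : ℝ := ∑ j, boolSign (ε j)

lemma sum_signSum_succ (k : ℕ) (F : ℝ → ℝ) :
    ∑ ε : Fin (k + 1) → Bool, F (signSum ε) =
      ∑ ε : Fin k → Bool, (F (signSum ε + 1) + F (signSum ε - 1)) := by
  rw [← (Fin.consEquiv fun _ : Fin (k + 1) => Bool).sum_comp, Fintype.sum_prod_type,
    Finset.sum_comm]
  refine Finset.sum_congr rfl fun ε _ => ?_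
  simp [Fin.consEquiv, signSum, Fin.sum_univ_succ, boolSign, add_comm, sub_eq_add_neg]

lemma sum_signSum_sq (k : ℕ) :
    ∑ ε : Fin k → Bool, signSum ε ^ 2 = 2 ^ k * (k : ℝ) := by
  induction k with
  | zero => simp [signSum]
  | succ k ih =>
    rw [sum_signSum_succ k (fun x => x ^ 2)]
    have h : ∀ x : ℝ, (x + 1) ^ 2 + (x - 1) ^ 2 = 2 * x ^ 2 + 2 := fun x => by ring
    simp only [h, Finset.sum_add_distrib, ← Finset.mul_sum, ih]
    simp
    ring

lemma sum_signSum_pow_four (k : ℕ) :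
    ∑ ε : Fin k → Bool, signSum ε ^ 4 = 2 ^ k * (3 * (k : ℝ) ^ 2 - 2 * k) := by
  induction k with
  | zero => simp [signSum]
  | succ k ih =>
    rw [sum_signSum_succ k (fun x => x ^ 4)]
    have h : ∀ x : ℝ, (x + 1) ^ 4 + (x - 1) ^ 4 = 2 * x ^ 4 + 12 * x ^ 2 + 2 := fun x => by ring
    simp only [h, Finset.sum_add_distrib, ← Finset.mul_sum, ih, sum_signSum_sq]
    simp
    ring

/-- Khintchine's inequality for equal coefficients, with constant `√3`. -/
lemma two_pow_mul_sqrt_le_sum_abs_signSum {k : ℕ} (hk : 0 < k) :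
    2 ^ k * √(k : ℝ) ≤ √3 * ∑ ε : Fin k → Bool, |signSum ε| := by
  set q := √(k : ℝ) with hq
  have hk' : (0 : ℝ) < k := by exact_mod_cast hk
  have hq0 : 0 < q := Real.sqrt_pos.mpr hk'
  have hqk : q ^ 2 = k := Real.sq_sqrt hk'.le
  have hs : √(3 : ℝ) ^ 2 = 3 := Real.sq_sqrt (by norm_num)
  have hs0 : 0 < √(3 : ℝ) := Real.sqrt_pos.mpr (by norm_num)
  have key : ∀ x : ℝ, 9 * q ^ 2 * x ^ 2 - x ^ 4 ≤ 6 * q ^ 3 * (√3 * |x|) := by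
    intro x
    have hx := abs_nonneg x
    have e2 : x ^ 2 = |x| ^ 2 := (sq_abs x).symm
    have e4 : x ^ 4 = |x| ^ 4 := by rw [← Even.pow_abs (by decide)]
    rw [e2, e4]
    have h : 0 ≤ |x| * ((|x| - √3 * q) ^ 2 * (|x| + 2 * √3 * q)) := by positivity
    have e : |x| * ((|x| - √3 * q) ^ 2 * (|x| + 2 * √3 * q)) =
        |x| ^ 4 - 9 * q ^ 2 * |x| ^ 2 + 6 * q ^ 3 * (√3 * |x|) := by
      linear_combination (|x| * (-3 * q ^ 2 * |x| + 2 * q ^ 3 * √3)) * hs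
    linarith
  have hsum := Finset.sum_le_sum fun (ε : Fin k → Bool) (_ : ε ∈ Finset.univ) => key (signSum ε)
  rw [Finset.sum_sub_distrib, ← Finset.mul_sum, ← Finset.mul_sum, ← Finset.mul_sum,
    sum_signSum_sq, sum_signSum_pow_four, ← hqk] at hsum
  have h2 : (0 : ℝ) < 2 ^ k := by positivity
  have h6 : 0 < 6 * q ^ 3 := by positivity
  refine le_of_mul_le_mul_left ?_ h6
  refine le_trans ?_ hsum
  nlinarith [mul_pos h2 (pow_pos hq0 2)]

lemma natCast_mul_sum_realSign_signSum {k : ℕ} (c : Fin k) :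
    (k : ℝ) * ∑ ε : Fin k → Bool, realSign (signSum ε) * boolSign (ε c) =
      ∑ ε : Fin k → Bool, |signSum ε| := by
  have h : ∀ c' : Fin k, ∑ ε : Fin k → Bool, realSign (signSum ε) * boolSign (ε c') =
      ∑ ε : Fin k → Bool, realSign (signSum ε) * boolSign (ε c) := by
    intro c'
    rw [← ((Equiv.swap c c').arrowCongr (Equiv.refl Bool)).sum_comp]
    refine Finset.sum_congr rfl fun ε _ => ?_
    have hS : signSum ((Equiv.swap c c').arrowCongr (Equiv.refl Bool) ε) = signSum ε :=
      (Equiv.swap c c').symm.sum_comp fun j => boolSign (ε j)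
    rw [hS]
    simp [Equiv.arrowCongr]
  calc (k : ℝ) * ∑ ε : Fin k → Bool, realSign (signSum ε) * boolSign (ε c)
      = ∑ c' : Fin k, ∑ ε : Fin k → Bool, realSign (signSum ε) * boolSign (ε c') := by
        simp [h]
    _ = _ := by
        rw [Finset.sum_comm]
        refine Finset.sum_congr rfl fun ε _ => ?_
        rw [← Finset.mul_sum]
        exact realSign_mul_self_eq_abs _

lemma sum_realSign_inner {k : ℕ} (b : Fin k → Bool) (c : Fin k) :
    (k : ℝ) * ∑ ε : Fin k → Bool,
        realSign (∑ j, boolSign (b j) * boolSign (ε j)) * boolSign (ε c) =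
      boolSign (b c) * ∑ ε : Fin k → Bool, |signSum ε| := by
  have hinv : Function.Involutive fun (ε : Fin k → Bool) j => b j == ε j := by
    intro ε
    funext j
    cases hb : b j <;> cases he : ε j <;> simp [hb, he]
  rw [← natCast_mul_sum_realSign_signSum c, ← Equiv.sum_comp hinv.toPerm, mul_left_comm,
    Finset.mul_sum _ _ (boolSign (b c))]
  congr 1
  refine Finset.sum_congr rfl fun ε _ => ?_
  simp only [Function.Involutive.coe_toPerm, boolSign_beq, ← mul_assoc, boolSign_mul_self,
    one_mul, signSum]
  ring

lemma Mnorm_le_of_eq_average {N d : ℕ} {ι : Type*} [Fintype ι] [Nonempty ι]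
    {T : TIndex N d → ℝ} {A : ι → TIndex N d → ℝ} (hA : ∀ i, A i ∈ signTensors N d) {t : ℝ}
    (ht : 0 < t) (hT : ∀ ω, T ω = t * ((Fintype.card ι : ℝ)⁻¹ * ∑ i, A i ω)) :
    Mnorm T ≤ t := by
  refine csInf_le ⟨0, fun s hs => hs.1.le⟩ ⟨ht, ?_⟩
  refine ⟨∑ i, (Fintype.card ι : ℝ)⁻¹ • A i, ?_, ?_⟩
  · refine (convex_convexHull ℝ _).sum_mem (fun _ _ => by positivity) ?_
      fun i _ => subset_convexHull ℝ _ (hA i)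
    simp
  · funext ω
    simp [hT, Finset.mul_sum]

/-- The order-`(m + 2)` tensor with entries `±a` that depends only on the first two indices, the
second one through the column map `c`. -/
def columnTensor {N k : ℕ} (m : ℕ) (a : ℝ) (c : Fin N → Fin k) (b : Fin N × Fin k → Bool) :
    TIndex N (m + 2) → ℝ :=
  fun ω => a * boolSign (b (ω 0, c (ω 1)))

lemma Mnorm_columnTensor_le {N k : ℕ} (hk : 0 < k) (m : ℕ) {a : ℝ} (ha : 0 < a)
    (c : Fin N → Fin k) (b : Fin N × Fin k → Bool) :
    Mnorm (columnTensor m a c b) ≤ √3 * (a * √(k : ℝ)) := by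
  set E := ∑ ε : Fin k → Bool, |signSum ε| with hE
  have hK := two_pow_mul_sqrt_le_sum_abs_signSum hk
  rw [← hE] at hK
  have hk' : (0 : ℝ) < k := by exact_mod_cast hk
  have hq0 : 0 < √(k : ℝ) := Real.sqrt_pos.mpr hk'
  have hqk : √(k : ℝ) * √(k : ℝ) = k := Real.mul_self_sqrt hk'.le
  have hs0 : 0 < √(3 : ℝ) := Real.sqrt_pos.mpr (by norm_num)
  have h2 : (0 : ℝ) < 2 ^ k := by positivity
  have hE0 : 0 < E := pos_of_mul_pos_right (lt_of_lt_of_le (by positivity) hK) hs0.le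
  refine le_trans (Mnorm_le_of_eq_average (ι := Fin k → Bool)
    (A := fun ε ω => realSign (∑ j, boolSign (b (ω 0, j)) * boolSign (ε j)) *
      boolSign (ε (c (ω 1)))) (t := a * (k * 2 ^ k / E)) ?_ (by positivity) ?_) ?_
  · intro ε
    refine ⟨Fin.cons (fun i => realSign (∑ j, boolSign (b (i, j)) * boolSign (ε j)))
      (Fin.cons (fun i => boolSign (ε (c i))) fun _ _ => 1), ?_, ?_⟩
    · refine Fin.cases (fun i => ?_) (Fin.cases (fun i => ?_) fun j i => ?_)
      · simpa using realSign_eq_or _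
      · simpa using boolSign_eq_or _
      · simp
    · intro ω
      simp [Fin.prod_univ_succ]
  · intro ω
    have h := sum_realSign_inner (fun j => b (ω 0, j)) (c (ω 1))
    rw [← hE] at h
    simp only [columnTensor, Fintype.card_fun, Fintype.card_bool, Fintype.card_fin, Nat.cast_pow,
      Nat.cast_ofNat]
    field_simp
    linarith
  · rw [mul_left_comm]
    refine mul_le_mul_of_nonneg_left ?_ ha.le
    rw [div_le_iff₀ hE0]
    nlinarith

lemma sum_two_coordinates (N m : ℕ) (F : Fin N → Fin N → ℝ) :
    ∑ ω : TIndex N (m + 2), F (ω 0) (ω 1) = (N : ℝ) ^ m * ∑ i, ∑ j, F i j := by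
  rw [← (Fin.consEquiv fun _ : Fin (m + 2) => Fin N).sum_comp, Fintype.sum_prod_type,
    Finset.mul_sum]
  refine Finset.sum_congr rfl fun i _ => ?_
  rw [← (Fin.consEquiv fun _ : Fin (m + 1) => Fin N).sum_comp, Fintype.sum_prod_type,
    Finset.mul_sum]
  refine Finset.sum_congr rfl fun j _ => ?_
  have h1 : ∀ (x : Fin N) (y : Fin (m + 1) → Fin N),
      (Fin.cons x y : Fin (m + 2) → Fin N) 1 = y 0 := fun _ _ => rfl
  simp [Fin.consEquiv, h1]

/-- The Hamming distance between Boolean vectors, with weight `w i` on coordinate `i`. -/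
def weightedDist {ι : Type*} [Fintype ι] (w : ι → ℝ) (b b' : ι → Bool) : ℝ :=
  ∑ i, w i * if b i ≠ b' i then 1 else 0

lemma weightedDist_self {ι : Type*} [Fintype ι] (w : ι → ℝ) (b : ι → Bool) :
    weightedDist w b b = 0 := by
  simp [weightedDist]

lemma weightedDist_comm {ι : Type*} [Fintype ι] (w : ι → ℝ) (b b' : ι → Bool) :
    weightedDist w b b' = weightedDist w b' b := by
  simp only [weightedDist, ne_comm]

lemma one_add_exp_neg_le (x : ℝ) : 1 + Real.exp (-x) ≤ 2 * Real.exp (-x / 2 + x ^ 2 / 8) := by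
  have h := Real.cosh_le_exp_half_sq (x / 2)
  have e : 1 + Real.exp (-x) = 2 * (Real.exp (-x / 2) * Real.cosh (x / 2)) := by
    rw [Real.cosh_eq]
    have h1 : Real.exp (-x / 2) * Real.exp (x / 2) = 1 := by
      rw [← Real.exp_add]; ring_nf; simp
    have h2 : Real.exp (-x / 2) * Real.exp (-(x / 2)) = Real.exp (-x) := by
      rw [← Real.exp_add]; ring_nf
    linear_combination -h1 - h2
  rw [e, Real.exp_add]
  have h' : (x / 2) ^ 2 / 2 = x ^ 2 / 8 := by ring
  rw [h'] at h
  gcongr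

/-- A Chernoff bound for the size of weighted Hamming balls. -/
lemma card_weightedDist_ball_le {ι : Type*} [Fintype ι] [DecidableEq ι] (w : ι → ℝ) (b : ι → Bool)
    (δ : ℝ) {t : ℝ} (ht : 0 ≤ t) :
    ((Finset.univ.filter fun b' => weightedDist w b b' < δ).card : ℝ) ≤
      2 ^ Fintype.card ι * Real.exp (t * δ - t * (∑ i, w i) / 2 + t ^ 2 * (∑ i, w i ^ 2) / 8) := by
  calc ((Finset.univ.filter fun b' => weightedDist w b b' < δ).card : ℝ)
      ≤ ∑ b' : ι → Bool, Real.exp (t * (δ - weightedDist w b b')) := by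
        rw [Finset.card_filter]
        push_cast
        refine Finset.sum_le_sum fun b' _ => ?_
        split_ifs with h
        · exact Real.one_le_exp (mul_nonneg ht (by linarith))
        · exact (Real.exp_pos _).le
    _ = Real.exp (t * δ) * ∏ i, ∑ a : Bool, Real.exp (-(t * w i) * if b i ≠ a then 1 else 0) := by
        rw [Finset.prod_univ_sum, Fintype.piFinset_univ, Finset.mul_sum]
        refine Finset.sum_congr rfl fun b' _ => ?_
        rw [← Real.exp_sum, ← Real.exp_add, weightedDist, mul_sub, sub_eq_add_neg,
          Finset.mul_sum, ← Finset.sum_neg_distrib]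
        congr 2
        exact Finset.sum_congr rfl fun i _ => by ring
    _ = Real.exp (t * δ) * ∏ i, (1 + Real.exp (-(t * w i))) := by
        congr 1
        refine Finset.prod_congr rfl fun i _ => ?_
        cases b i <;> simp [add_comm]
    _ ≤ Real.exp (t * δ) * ∏ i, (2 * Real.exp (-(t * w i) / 2 + (t * w i) ^ 2 / 8)) := by
        gcongr with i
        exact one_add_exp_neg_le _
    _ = _ := by
        rw [Finset.prod_mul_distrib, Finset.prod_const, ← Real.exp_sum, Finset.card_univ,
          mul_left_comm, ← Real.exp_add]
        congr 2
        rw [Finset.sum_add_distrib, Finset.mul_sum, Finset.mul_sum, Finset.sum_div,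
          Finset.sum_div]
        have e : ∑ i, -(t * w i) / 2 = -∑ i, t * w i / 2 := by
          rw [← Finset.sum_neg_distrib]
          exact Finset.sum_congr rfl fun i _ => by ring
        rw [e]
        simp only [mul_pow]
        ring

/-- A Gilbert–Varshamov bound: a maximal separated set covers the space by balls. -/
lemma exists_separated_of_ball_card_le {β : Type*} [Fintype β] (D : β → β → ℝ)
    {δ M : ℝ} (hself : ∀ b, D b b < δ) (hcomm : ∀ b b', D b b' = D b' b)
    (hball : ∀ b, ((Finset.univ.filter fun b' => D b b' < δ).card : ℝ) ≤ M) :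
    ∃ S : Finset β, (Fintype.card β : ℝ) ≤ S.card * M ∧
      ∀ b ∈ S, ∀ b' ∈ S, b ≠ b' → δ ≤ D b b' := by
  obtain ⟨S, hS⟩ := (Set.toFinite
    {S : Finset β | ∀ b ∈ S, ∀ b' ∈ S, b ≠ b' → δ ≤ D b b'}).exists_maximal ⟨∅, by simp⟩
  refine ⟨S, ?_, hS.1⟩
  have hcover : (Finset.univ : Finset β) ⊆
      S.biUnion fun b => Finset.univ.filter fun b' => D b b' < δ := by
    intro x _
    by_contra hx
    simp only [Finset.mem_biUnion, Finset.mem_filter, Finset.mem_univ, true_and, not_exists,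
      not_and, not_lt] at hx
    have hmem : insert x S ∈ {S : Finset β | ∀ b ∈ S, ∀ b' ∈ S, b ≠ b' → δ ≤ D b b'} := by
      intro b hb b' hb' hne
      rcases Finset.mem_insert.mp hb with rfl | hbS <;>
        rcases Finset.mem_insert.mp hb' with rfl | hbS'
      · exact absurd rfl hne
      · exact hcomm b b' ▸ hx b' hbS'
      · exact hx b hbS
      · exact hS.1 b hbS b' hbS' hne
    have hxS : x ∈ S := hS.2 hmem (Finset.subset_insert x S) (Finset.mem_insert_self x S)
    exact absurd (hself x) (not_lt.mpr (hx x hxS))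
  calc (Fintype.card β : ℝ)
      ≤ ((S.biUnion fun b => Finset.univ.filter fun b' => D b b' < δ).card : ℝ) := by
        exact_mod_cast Finset.card_le_card hcover
    _ ≤ ∑ b ∈ S, ((Finset.univ.filter fun b' => D b b' < δ).card : ℝ) := by
        exact_mod_cast Finset.card_biUnion_le
    _ ≤ ∑ _b ∈ S, M := Finset.sum_le_sum fun b _ => hball b
    _ = S.card * M := by simp

/-- If `1 ≤ k ≤ N` then `Fin N` can be mapped to `Fin k` with all fibers of size at most
`2 * N / k`. -/
lemma exists_map_card_fiber_le {N k : ℕ} (hk : 0 < k) (hkN : k ≤ N) :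
    ∃ c : Fin N → Fin k, ∀ a,
      (k : ℝ) * ((Finset.univ.filter fun j => c j = a).card : ℝ) ≤ 2 * N := by
  refine ⟨fun j => ⟨j % k, Nat.mod_lt _ hk⟩, fun a => ?_⟩
  have h : (Finset.univ.filter fun j : Fin N => (⟨j % k, Nat.mod_lt _ hk⟩ : Fin k) = a).card ≤
      (Finset.range (N / k + 1)).card := by
    refine Finset.card_le_card_of_injOn (fun j => (j : ℕ) / k) ?_ ?_
    · intro j _
      simpa using Nat.lt_succ_of_le (Nat.div_le_div_right j.2.le)
    · intro i hi j hj hij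
      simp only [Finset.coe_filter, Finset.mem_univ, true_and, Set.mem_ofPred_eq,
        Fin.ext_iff] at hi hj hij
      rw [Fin.ext_iff, ← Nat.div_add_mod (i : ℕ) k, ← Nat.div_add_mod (j : ℕ) k, hi, hj, hij]
  rw [Finset.card_range] at h
  have h2 : k * (N / k) ≤ N := Nat.mul_div_le N k
  have h3 : k * (Finset.univ.filter fun j : Fin N =>
      (⟨j % k, Nat.mod_lt _ hk⟩ : Fin k) = a).card ≤ 2 * N := by nlinarith
  exact_mod_cast h3

lemma exists_separated_codewords {N k : ℕ} (hk : 0 < k) (hN : 0 < N) (c : Fin N → Fin k)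
    (hc : ∀ a, (k : ℝ) * ((Finset.univ.filter fun j => c j = a).card : ℝ) ≤ 2 * N) :
    ∃ S : Finset (Fin N × Fin k → Bool), Real.exp ((k : ℝ) * N / 8) ≤ S.card ∧
      ∀ b ∈ S, ∀ b' ∈ S, b ≠ b' →
        (N : ℝ) ^ 2 / 8 ≤ ∑ i, ∑ j, if b (i, c j) ≠ b' (i, c j) then (1 : ℝ) else 0 := by
  have hk' : (0 : ℝ) < k := by exact_mod_cast hk
  have hN' : (0 : ℝ) < N := by exact_mod_cast hN
  set w : Fin N × Fin k → ℝ := fun p => ((Finset.univ.filter fun j => c j = p.2).card : ℝ) with hw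
  have hfib : ∀ f : Fin k → ℝ,
      ∑ a, ((Finset.univ.filter fun j => c j = a).card : ℝ) * f a = ∑ j, f (c j) := by
    intro f
    rw [← Finset.sum_fiberwise Finset.univ c fun j => f (c j)]
    refine Finset.sum_congr rfl fun a _ => ?_
    rw [Finset.sum_congr rfl fun j hj => by rw [(Finset.mem_filter.mp hj).2]]
    simp
  have hdist : ∀ b b', weightedDist w b b' =
      ∑ i, ∑ j, if b (i, c j) ≠ b' (i, c j) then (1 : ℝ) else 0 := by
    intro b b'
    rw [weightedDist, Fintype.sum_prod_type]
    exact Finset.sum_congr rfl fun i _ =>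
      hfib fun a => if b (i, a) ≠ b' (i, a) then (1 : ℝ) else 0
  have hsum : ∑ p, w p = (N : ℝ) ^ 2 := by
    have h := hfib fun _ => 1
    simp only [mul_one] at h
    rw [Fintype.sum_prod_type]
    simp only [hw, h]
    simp [sq]
  have hsq : k * ∑ p, w p ^ 2 ≤ 2 * (N : ℝ) ^ 3 := by
    calc k * ∑ p, w p ^ 2 = ∑ p, (k * w p) * w p := by
          rw [Finset.mul_sum]
          exact Finset.sum_congr rfl fun p _ => by ring
      _ ≤ ∑ p, (2 * N) * w p :=
          Finset.sum_le_sum fun p _ => mul_le_mul_of_nonneg_right (hc p.2) (Nat.cast_nonneg _)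
      _ = 2 * (N : ℝ) ^ 3 := by rw [← Finset.mul_sum, hsum]; ring
  have hball : ∀ b, ((Finset.univ.filter fun b' =>
      weightedDist w b b' < (N : ℝ) ^ 2 / 8).card : ℝ) ≤
        2 ^ (N * k) * Real.exp (-(k * N / 8)) := by
    intro b
    refine (card_weightedDist_ball_le w b ((N : ℝ) ^ 2 / 8) (t := k / N)
      (by positivity)).trans ?_
    rw [Fintype.card_prod, Fintype.card_fin, Fintype.card_fin, hsum]
    gcongr
    have h1 : ((k : ℝ) / N) ^ 2 * (∑ p, w p ^ 2) ≤ 2 * (k * N) := by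
      calc ((k : ℝ) / N) ^ 2 * (∑ p, w p ^ 2) = k / N ^ 2 * (k * ∑ p, w p ^ 2) := by ring
        _ ≤ k / N ^ 2 * (2 * (N : ℝ) ^ 3) := by gcongr
        _ = 2 * (k * N) := by field_simp
    have h2 : (k : ℝ) / N * (N : ℝ) ^ 2 = k * N := by field_simp
    linarith
  obtain ⟨S, hcard, hsep⟩ := exists_separated_of_ball_card_le (weightedDist w)
    (fun b => by rw [weightedDist_self]; positivity) (weightedDist_comm w) hball
  refine ⟨S, ?_, fun b hb b' hb' hne => hdist b b' ▸ hsep b hb b' hb' hne⟩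
  have h2 : (0 : ℝ) < 2 ^ (N * k) := by positivity
  rw [Fintype.card_fun, Fintype.card_prod, Fintype.card_fin, Fintype.card_fin, Fintype.card_bool,
    Nat.cast_pow, Nat.cast_ofNat, mul_left_comm, Real.exp_neg] at hcard
  have h3 := le_of_mul_le_mul_left ((mul_one _).trans_le hcard) h2
  rwa [← div_eq_mul_inv, one_le_div (Real.exp_pos _)] at h3

lemma frobSq_columnTensor_sub {N k : ℕ} (m : ℕ) (a : ℝ) (c : Fin N → Fin k)
    (b b' : Fin N × Fin k → Bool) :
    frobSq (fun ω => columnTensor m a c b ω - columnTensor m a c b' ω) =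
      4 * a ^ 2 * (N : ℝ) ^ m *
        ∑ i, ∑ j, if b (i, c j) ≠ b' (i, c j) then (1 : ℝ) else 0 := by
  rw [mul_assoc, ← sum_two_coordinates N m
    fun i j => if b (i, c j) ≠ b' (i, c j) then (1 : ℝ) else 0, Finset.mul_sum, frobSq]
  refine Finset.sum_congr rfl fun ω _ => ?_
  rw [columnTensor, columnTensor, ← mul_sub, mul_pow, sq_boolSign_sub]
  ring

/-- packing set for the set of tensors with bounded M-norm. -/
theorem packing_set_Mnorm :
    ∃ KG : ℝ, 1 ≤ KG ∧ KG < 1.8 ∧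
      ∀ (d N r : ℕ) (α γ : ℝ),
        2 ≤ d → 1 ≤ N → 1 ≤ r → 0 < α → 0 < γ → γ ≤ 1 →
        (∃ k : ℕ, (r : ℝ) / γ ^ 2 = (k : ℝ)) → (r : ℝ) / γ ^ 2 ≤ (N : ℝ) →
        ∃ χ : Finset (TIndex N d → ℝ),
          Real.exp ((r : ℝ) * N / (16 * γ ^ 2)) ≤ (χ.card : ℝ) ∧
          (∀ T ∈ χ, (∀ ω : TIndex N d, |T ω| = α * γ) ∧
            Mnorm T ≤ KG * α * Real.sqrt r) ∧
          (∀ T ∈ χ, ∀ T' ∈ χ, T ≠ T' →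
            α ^ 2 * γ ^ 2 * (N : ℝ) ^ d / 2 ≤ frobSq (fun ω => T ω - T' ω)) := by
  refine ⟨√3, ?_, ?_, ?_⟩
  · exact Real.one_le_sqrt.mpr (by norm_num)
  · rw [Real.sqrt_lt' (by norm_num)]
    norm_num
  intro d N r α γ hd hN hr hα hγ _ ⟨k, hk⟩ hkN
  obtain ⟨m, rfl⟩ := Nat.exists_eq_add_of_le' hd
  have hr' : (0 : ℝ) < r := by exact_mod_cast hr
  have hN' : (0 : ℝ) < N := by exact_mod_cast hN
  rw [hk] at hkN
  have hk0 : 0 < k := by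
    have : (0 : ℝ) < k := hk ▸ (by positivity)
    exact_mod_cast this
  have hrk : (r : ℝ) = γ ^ 2 * k := by
    rw [← hk]
    field_simp
  have hsqrt : √(r : ℝ) = γ * √(k : ℝ) := by
    rw [hrk, Real.sqrt_mul (sq_nonneg γ), Real.sqrt_sq hγ.le]
  have ha : 0 < α * γ := mul_pos hα hγ
  obtain ⟨c, hc⟩ := exists_map_card_fiber_le hk0 (by exact_mod_cast hkN)
  obtain ⟨S, hcard, hsep⟩ := exists_separated_codewords hk0 hN c hc
  have hfrob : ∀ b ∈ S, ∀ b' ∈ S, b ≠ b' → α ^ 2 * γ ^ 2 * (N : ℝ) ^ (m + 2) / 2 ≤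
      frobSq (fun ω => columnTensor m (α * γ) c b ω - columnTensor m (α * γ) c b' ω) := by
    intro b hb b' hb' hne
    rw [frobSq_columnTensor_sub]
    calc α ^ 2 * γ ^ 2 * (N : ℝ) ^ (m + 2) / 2
        = 4 * (α * γ) ^ 2 * (N : ℝ) ^ m * ((N : ℝ) ^ 2 / 8) := by ring
      _ ≤ _ := mul_le_mul_of_nonneg_left (hsep b hb b' hb' hne) (by positivity)
  have hinj : Set.InjOn (columnTensor m (α * γ) c) S := by
    intro b hb b' hb' heq
    by_contra hne
    have h := hfrob b hb b' hb' hne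
    rw [heq] at h
    have h0 : 0 < α ^ 2 * γ ^ 2 * (N : ℝ) ^ (m + 2) / 2 := by positivity
    simp only [frobSq, sub_self] at h
    norm_num at h
    linarith
  refine ⟨S.image (columnTensor m (α * γ) c), ?_, ?_, ?_⟩
  · rw [Finset.card_image_of_injOn hinj]
    refine le_trans (Real.exp_le_exp.mpr ?_) hcard
    have e : (r : ℝ) * N / (16 * γ ^ 2) = k * N / 16 := by
      rw [hrk]
      field_simp
    rw [e]
    have : (0 : ℝ) ≤ k * N := by positivity
    linarith
  · intro T hT
    obtain ⟨b, _, rfl⟩ := Finset.mem_image.mp hT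
    refine ⟨fun ω => ?_, ?_⟩
    · rw [columnTensor, abs_mul, abs_boolSign, mul_one, abs_of_pos ha]
    · refine (Mnorm_columnTensor_le hk0 m ha c b).trans_eq ?_
      rw [hsqrt]
      ring
  · intro T hT T' hT' hne
    obtain ⟨b, hb, rfl⟩ := Finset.mem_image.mp hT
    obtain ⟨b', hb', rfl⟩ := Finset.mem_image.mp hT'
    exact hfrob b hb b' hb' fun h => hne (h ▸ rfl)

end
end

section
/- Let σ > 0 and f(x) = Φ(x/σ), where Φ is the cumulative distribution function of a standard Gaussian random variable, so f'(x) = (1/σ) φ(x/σ) with φ the standard Gaussian density. Then for every α > 0, the steepness constant satisfies L_α = sup_{|x|≤α} |f'(x)|/(f(x)(1−f(x))) ≤ (4/σ)(α/σ + 1). -/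
open scoped BigOperators
open Classical MeasureTheory Pointwise

noncomputable section

/-- The standard Gaussian density `φ`. -/
def stdGaussianDensity (s : ℝ) : ℝ := Real.exp (-s ^ 2 / 2) / Real.sqrt (2 * Real.pi)

lemma stdGaussianDensity_pos (t : ℝ) : 0 < stdGaussianDensity t := by
  unfold stdGaussianDensity
  positivity

lemma stdGaussianDensity_neg (t : ℝ) : stdGaussianDensity (-t) = stdGaussianDensity t := by
  simp [stdGaussianDensity]

lemma stdGaussianDensity_le_one (t : ℝ) : stdGaussianDensity t ≤ 1 := by
  unfold stdGaussianDensity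
  rw [div_le_one (by positivity)]
  have h₁ : Real.exp (-t ^ 2 / 2) ≤ 1 := Real.exp_le_one_iff.2 (by nlinarith [sq_nonneg t])
  have h₂ : 1 ≤ Real.sqrt (2 * Real.pi) := Real.one_le_sqrt.2 (by linarith [Real.pi_gt_three])
  exact h₁.trans h₂

lemma continuous_stdGaussianDensity : Continuous stdGaussianDensity := by
  unfold stdGaussianDensity
  fun_prop

lemma hasDerivAt_stdGaussianDensity (t : ℝ) :
    HasDerivAt stdGaussianDensity (-t * stdGaussianDensity t) t := by
  have h : HasDerivAt (fun s : ℝ => -s ^ 2 / 2) (-t) t := by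
    refine ((hasDerivAt_pow 2 t).fun_neg.div_const 2).congr_deriv ?_
    push_cast
    ring
  refine (h.exp.div_const (Real.sqrt (2 * Real.pi))).congr_deriv ?_
  unfold stdGaussianDensity
  ring

lemma integrable_stdGaussianDensity : Integrable stdGaussianDensity := by
  have h := (integrable_exp_neg_mul_sq (b := 1 / 2) (by norm_num)).div_const
    (Real.sqrt (2 * Real.pi))
  refine h.congr (Filter.Eventually.of_forall fun s => ?_)
  simp only [stdGaussianDensity]
  ring_nf

lemma integral_stdGaussianDensity : ∫ s, stdGaussianDensity s = 1 := by
  have h := integral_gaussian (1 / 2)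
  rw [show Real.pi / (1 / 2) = 2 * Real.pi by ring] at h
  unfold stdGaussianDensity
  rw [integral_div, div_eq_one_iff_eq (by positivity), ← h]
  congr 1 with s
  ring_nf

lemma stdGaussianCDF_eq_integral (t : ℝ) :
    stdGaussianCDF t = ∫ s in Set.Iic t, stdGaussianDensity s := rfl

lemma stdGaussianCDF_neg (t : ℝ) :
    stdGaussianCDF (-t) = ∫ s in Set.Ioi t, stdGaussianDensity s := by
  have h := integral_comp_neg_Iic (-t) stdGaussianDensity
  simp only [stdGaussianDensity_neg, neg_neg] at h
  exact h

lemma one_sub_stdGaussianCDF (t : ℝ) : 1 - stdGaussianCDF t = stdGaussianCDF (-t) := by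
  rw [stdGaussianCDF_neg, stdGaussianCDF_eq_integral, ← integral_stdGaussianDensity,
    ← intervalIntegral.integral_Iic_add_Ioi (b := t) integrable_stdGaussianDensity.integrableOn
      integrable_stdGaussianDensity.integrableOn]
  ring

lemma hasDerivAt_stdGaussianCDF (t : ℝ) :
    HasDerivAt stdGaussianCDF (stdGaussianDensity t) t := by
  have h : stdGaussianCDF =
      fun u => (∫ s in (0 : ℝ)..u, stdGaussianDensity s) + stdGaussianCDF 0 := by
    funext u
    rw [← intervalIntegral.integral_Iic_sub_Iic integrable_stdGaussianDensity.integrableOn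
      integrable_stdGaussianDensity.integrableOn]
    simp only [stdGaussianCDF_eq_integral]
    ring
  rw [h]
  exact (continuous_stdGaussianDensity.integral_hasStrictDerivAt 0 t).hasDerivAt.add_const _

lemma monotone_stdGaussianCDF : Monotone stdGaussianCDF :=
  monotone_of_hasDerivAt_nonneg hasDerivAt_stdGaussianCDF fun t => (stdGaussianDensity_pos t).le

/-- A lower bound of Mills-ratio type for the Gaussian tail. -/
lemma stdGaussianDensity_div_le_stdGaussianCDF_neg {t : ℝ} (ht : 0 ≤ t) :
    stdGaussianDensity t / (t + 1) ≤ stdGaussianCDF (-t) := by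
  set g' : ℝ → ℝ := fun s =>
    (-s * stdGaussianDensity s * (s + 1) - stdGaussianDensity s * 1) / (s + 1) ^ 2 with hg'
  have hderiv : ∀ s ∈ Set.Ici t,
      HasDerivAt (fun s => stdGaussianDensity s / (s + 1)) (g' s) s := fun s hs =>
    (hasDerivAt_stdGaussianDensity s).div ((hasDerivAt_id s).add_const 1)
      (ne_of_gt (add_pos_of_nonneg_of_pos (ht.trans hs) one_pos))
  have hneg : ∀ s ∈ Set.Ioi t, g' s ≤ 0 := fun s hs => by
    have hs' : 0 < s := ht.trans_lt hs
    have := stdGaussianDensity_pos s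
    refine div_nonpos_of_nonpos_of_nonneg ?_ (by positivity)
    have : 0 < s * stdGaussianDensity s * (s + 1) := by positivity
    linarith
  have hlim : Filter.Tendsto (fun s => stdGaussianDensity s / (s + 1)) Filter.atTop (nhds 0) := by
    refine squeeze_zero' ?_ ?_ (tendsto_inv_atTop_zero.comp
      (Filter.tendsto_atTop_add_const_right _ (1 : ℝ) Filter.tendsto_id))
    · filter_upwards [Filter.eventually_ge_atTop 0] with s hs
      have := stdGaussianDensity_pos s
      positivity
    · filter_upwards [Filter.eventually_ge_atTop 0] with s hs
      simp only [Function.comp, id]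
      rw [div_eq_mul_inv]
      exact mul_le_of_le_one_left (by positivity) (stdGaussianDensity_le_one s)
  have hint := integral_Ioi_of_hasDerivAt_of_nonpos' hderiv hneg hlim
  have hle : ∫ s in Set.Ioi t, -g' s ≤ ∫ s in Set.Ioi t, stdGaussianDensity s := by
    refine setIntegral_mono_on (integrableOn_Ioi_deriv_of_nonpos' hderiv hneg hlim).neg
      integrable_stdGaussianDensity.integrableOn measurableSet_Ioi fun s hs => ?_
    have hs' : 0 < s := ht.trans_lt hs
    have hpos : 0 < s * stdGaussianDensity s := mul_pos hs' (stdGaussianDensity_pos s)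
    rw [hg', ← neg_div, div_le_iff₀ (by positivity)]
    nlinarith
  rw [integral_neg, hint] at hle
  rw [stdGaussianCDF_neg]
  linarith

lemma stdGaussianCDF_pos (t : ℝ) : 0 < stdGaussianCDF t := by
  have h := stdGaussianDensity_div_le_stdGaussianCDF_neg (abs_nonneg t)
  have hpos : 0 < stdGaussianDensity |t| / (|t| + 1) :=
    div_pos (stdGaussianDensity_pos _) (by positivity)
  exact (hpos.trans_le h).trans_le (monotone_stdGaussianCDF (neg_abs_le t))

lemma stdGaussianDensity_le_mul_stdGaussianCDF (t : ℝ) :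
    stdGaussianDensity t ≤ 2 * (|t| + 1) * (stdGaussianCDF t * stdGaussianCDF (-t)) := by
  wlog ht : 0 ≤ t generalizing t
  · have := this (-t) (by linarith)
    rwa [stdGaussianDensity_neg, abs_neg, neg_neg, mul_comm (stdGaussianCDF (-t))] at this
  have h₁ := stdGaussianDensity_div_le_stdGaussianCDF_neg ht
  rw [div_le_iff₀ (by positivity)] at h₁
  have h₂ := one_sub_stdGaussianCDF t
  have h₃ := monotone_stdGaussianCDF (show -t ≤ t by linarith)
  have h₄ : 0 < stdGaussianCDF (-t) * (t + 1) := mul_pos (stdGaussianCDF_pos _) (by positivity)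
  rw [abs_of_nonneg ht]
  nlinarith

/-- steepness constant bound for the probit link function. -/
theorem probit_Lconst (σ α : ℝ) (hσ : 0 < σ) (hα : 0 < α) :
    Lconst (fun x => stdGaussianCDF (x / σ)) α ≤ (4 / σ) * (α / σ + 1) := by
  have hσα : 0 ≤ α / σ := by positivity
  refine Real.sSup_le ?_ (by positivity)
  rintro _ ⟨x, hx, rfl⟩
  have hx' : |x / σ| ≤ α / σ := by
    rw [abs_div, abs_of_pos hσ]
    exact div_le_div_of_nonneg_right hx hσ.le
  have hderiv : deriv (fun x => stdGaussianCDF (x / σ)) x = stdGaussianDensity (x / σ) * (1 / σ) :=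
    ((hasDerivAt_stdGaussianCDF (x / σ)).comp (h := fun y => y / σ) x
      ((hasDerivAt_id' x).div_const σ)).deriv
  have hprod : 0 < stdGaussianCDF (x / σ) * stdGaussianCDF (-(x / σ)) :=
    mul_pos (stdGaussianCDF_pos _) (stdGaussianCDF_pos _)
  simp only [hderiv, one_sub_stdGaussianCDF]
  rw [abs_of_pos (mul_pos (stdGaussianDensity_pos _) (by positivity)), div_le_iff₀ hprod]
  calc stdGaussianDensity (x / σ) * (1 / σ)
      ≤ 4 * (α / σ + 1) * (stdGaussianCDF (x / σ) * stdGaussianCDF (-(x / σ))) * (1 / σ) := by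
        gcongr
        refine (stdGaussianDensity_le_mul_stdGaussianCDF _).trans ?_
        gcongr
        norm_num
    _ = 4 / σ * (α / σ + 1) * (stdGaussianCDF (x / σ) * stdGaussianCDF (-(x / σ))) := by ring

end
end

section
/- Let d ≥ 2, N ≥ 1, and let T be a nonzero order-d tensor of size N with rank at most r and ‖T‖_∞ = α. Then α ≤ ‖T‖_M ≤ (r√r)^{d−1} · α. -/
open scoped BigOperators
open Classical MeasureTheory Pointwise

noncomputable section

/-- A finite family spanning `V` contains a basis with respect to which all members of the family
have coordinates in `[-1, 1]`: take a subfamily of maximal determinant. -/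
theorem exists_bounded_coeff_of_span_eq_top {ι V : Type*} [Finite ι] [AddCommGroup V] [Module ℝ V]
    [FiniteDimensional ℝ V] (v : ι → V) (hv : Submodule.span ℝ (Set.range v) = ⊤) :
    ∃ (s : Fin (Module.finrank ℝ V) → ι) (c : ι → Fin (Module.finrank ℝ V) → ℝ),
      (∀ i j, |c i j| ≤ 1) ∧ ∀ i, v i = ∑ j, c i j • v (s j) := by
  set b := Module.finBasis ℝ V
  obtain ⟨s₀, hs₀⟩ : ∃ s : Fin (Module.finrank ℝ V) → ι, b.det (v ∘ s) ≠ 0 := by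
    have h := Submodule.exists_fun_fin_finrank_span_eq ℝ (Set.range v)
    rw [hv, finrank_top] at h
    obtain ⟨f, hf, hspan, hli⟩ := h
    choose s hs using hf
    refine ⟨s, ?_⟩
    have hfs : v ∘ s = f := funext hs
    rw [hfs]
    exact ((b.is_basis_iff_det).1 ⟨hli, hspan⟩).ne_zero
  have : Nonempty (Fin (Module.finrank ℝ V) → ι) := ⟨s₀⟩
  obtain ⟨s, hs⟩ := Finite.exists_max fun s : Fin (Module.finrank ℝ V) → ι => |b.det (v ∘ s)|
  have hpos : 0 < |b.det (v ∘ s)| := (abs_pos.2 hs₀).trans_le (hs s₀)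
  obtain ⟨hli, hspan⟩ := (b.is_basis_iff_det).2 (abs_pos.1 hpos).isUnit
  let e := Module.Basis.mk hli hspan.ge
  have hsum (i : ι) : v i = ∑ j, e.repr (v i) j • v (s j) := by
    conv_lhs => rw [← e.sum_repr (v i)]
    simp [e]
  refine ⟨s, fun i j => e.repr (v i) j, fun i j => ?_, hsum⟩
  have hdet : b.det (v ∘ Function.update s j i) = e.repr (v i) j * b.det (v ∘ s) := by
    have h : b.det (Function.update (v ∘ s) j (v i)) = e.repr (v i) j * b.det (v ∘ s) := by
      have := congrFun (congrArg DFunLike.coe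
        (Module.Basis.det_smul_mk_coord_eq_det_update (e := b) hli hspan.ge j)) (v i)
      simpa [mul_comm, e] using this.symm
    rwa [Function.comp_update]
  have h := hs (Function.update s j i)
  simp only [hdet, abs_mul] at h
  exact le_of_mul_le_mul_right (by simpa using h) hpos

/-- A finite family of vectors has a subfamily, of size the rank of the family, in which
all its members can be expanded with coefficients in `[-1, 1]`. -/
theorem exists_bounded_coeff {ι V : Type*} [Finite ι] [AddCommGroup V] [Module ℝ V]
    [FiniteDimensional ℝ V] (v : ι → V) :
    ∃ k ≤ Module.finrank ℝ V, ∃ (s : Fin k → ι) (c : ι → Fin k → ℝ),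
      (∀ i j, |c i j| ≤ 1) ∧ ∀ i, v i = ∑ j, c i j • v (s j) := by
  let W := Submodule.span ℝ (Set.range v)
  let w : ι → W := fun i => ⟨v i, Submodule.subset_span ⟨i, rfl⟩⟩
  have hw : Submodule.span ℝ (Set.range w) = ⊤ := by
    have h : Set.range w = ((↑) : W → V) ⁻¹' Set.range v := by
      ext x
      simp [w, Subtype.ext_iff]
    rw [h]
    exact Submodule.span_span_coe_preimage
  obtain ⟨s, c, hc, h⟩ := exists_bounded_coeff_of_span_eq_top w hw
  refine ⟨Module.finrank ℝ W, Submodule.finrank_le W, s, c, hc, fun i => ?_⟩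
  simpa [w] using congrArg Subtype.val (h i)

/-- The cube `[-1, 1]^ι` is the convex hull of its vertices. -/
theorem mem_convexHull_sign_vectors {ι : Type*} [Finite ι] {x : ι → ℝ} (hx : ∀ i, |x i| ≤ 1) :
    x ∈ convexHull ℝ {y : ι → ℝ | ∀ i, y i = 1 ∨ y i = -1} := by
  have h : {y : ι → ℝ | ∀ i, y i = 1 ∨ y i = -1} = Set.univ.pi fun _ => {1, -1} := by
    ext y
    simp
  rw [h, convexHull_pi, Set.mem_univ_pi]
  intro i
  rw [convexHull_pair, segment_symm, segment_eq_Icc (by norm_num)]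
  exact abs_le.1 (hx i)

theorem abs_le_one_of_mem_convexHull_signTensors {N d : ℕ} {T : TIndex N d → ℝ}
    (hT : T ∈ convexHull ℝ (signTensors N d)) (ω : TIndex N d) : |T ω| ≤ 1 := by
  have hsub : signTensors N d ⊆ {T | T ω ∈ Set.Icc (-1 : ℝ) 1} := by
    rintro S ⟨u, hu, hS⟩
    have h : |S ω| = 1 := by
      rw [hS, Finset.abs_prod]
      exact Finset.prod_eq_one fun j _ => by rcases hu j (ω j) with h | h <;> simp [h]
    exact abs_le.1 h.le
  have hconv : Convex ℝ {T : TIndex N d → ℝ | T ω ∈ Set.Icc (-1 : ℝ) 1} :=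
    (convex_Icc (-1 : ℝ) 1).linear_preimage (LinearMap.proj ω : (TIndex N d → ℝ) →ₗ[ℝ] ℝ)
  exact abs_le.2 (convexHull_min hsub hconv hT)

/-- Prepending a bounded vector as a new factor preserves the convex hull of the sign tensors. -/
theorem outer_mem_convexHull_signTensors {N d : ℕ} {c : Fin N → ℝ} (hc : ∀ i, |c i| ≤ 1)
    {S : TIndex N d → ℝ} (hS : S ∈ convexHull ℝ (signTensors N d)) :
    (fun ω : TIndex N (d + 1) => c (ω 0) * S (Fin.tail ω)) ∈
      convexHull ℝ (signTensors N (d + 1)) := by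
  have hK : Convex ℝ (convexHull ℝ (signTensors N (d + 1))) := convex_convexHull ℝ _
  have hsign : ∀ c : Fin N → ℝ, (∀ i, c i = 1 ∨ c i = -1) →
      (fun ω : TIndex N (d + 1) => c (ω 0) * S (Fin.tail ω)) ∈
        convexHull ℝ (signTensors N (d + 1)) := by
    intro c hc
    let L : (TIndex N d → ℝ) →ₗ[ℝ] (TIndex N (d + 1) → ℝ) :=
      { toFun := fun S ω => c (ω 0) * S (Fin.tail ω)
        map_add' := fun _ _ => by ext; simp [mul_add]
        map_smul' := fun _ _ => by ext; simp [mul_left_comm] }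
    refine convexHull_min (t := L ⁻¹' _) ?_ (hK.linear_preimage L) hS
    rintro S ⟨u, hu, hSu⟩
    refine subset_convexHull ℝ _ ⟨Fin.cons c u, fun j => ?_, fun ω => ?_⟩
    · refine Fin.cases ?_ (fun j => ?_) j
      · exact hc
      · exact hu j
    · simp [L, hSu, Fin.prod_univ_succ, Fin.tail]
  let L : (Fin N → ℝ) →ₗ[ℝ] (TIndex N (d + 1) → ℝ) :=
    { toFun := fun c ω => c (ω 0) * S (Fin.tail ω)
      map_add' := fun _ _ => by ext; simp [add_mul]
      map_smul' := fun _ _ => by ext; simp [mul_assoc] }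
  exact convexHull_min (t := L ⁻¹' _) hsign (hK.linear_preimage L)
    (mem_convexHull_sign_vectors hc)

theorem mem_convexHull_signTensors_one {N : ℕ} {T : TIndex N 1 → ℝ} (hT : ∀ ω, |T ω| ≤ 1) :
    T ∈ convexHull ℝ (signTensors N 1) := by
  refine convexHull_mono ?_ (mem_convexHull_sign_vectors hT)
  intro S hS
  refine ⟨fun _ i => S fun _ => i, fun _ i => hS _, fun ω => ?_⟩
  simp only [Fin.prod_univ_one]
  congr 1
  ext j
  rw [Subsingleton.elim j 0]

theorem zero_mem_convexHull_signTensors (N d : ℕ) :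
    (0 : TIndex N (d + 1) → ℝ) ∈ convexHull ℝ (signTensors N (d + 1)) := by
  have h : (fun _ => 1 : TIndex N d → ℝ) ∈ convexHull ℝ (signTensors N d) :=
    subset_convexHull ℝ _ ⟨fun _ _ => 1, by simp, by simp⟩
  have := outer_mem_convexHull_signTensors (c := 0) (by simp) h
  simpa [← Pi.zero_def] using this

/-- A sum of at most `r` elements of a convex set containing `0` lies in the `r`-fold dilate. -/
theorem Convex.sum_mem_natCast_smul {E : Type*} [AddCommGroup E] [Module ℝ E] {K : Set E}
    (hK : Convex ℝ K) (h0 : 0 ∈ K) {k r : ℕ} (hkr : k ≤ r) {x : Fin k → E}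
    (hx : ∀ j, x j ∈ K) : ∑ j, x j ∈ (r : ℝ) • K := by
  have hsum : ∑ j, x j ∈ (k : ℝ) • K := by
    clear hkr
    induction k with
    | zero => exact ⟨0, h0, by simp⟩
    | succ k ih =>
      rw [Fin.sum_univ_castSucc, Nat.cast_succ, hK.add_smul k.cast_nonneg zero_le_one, one_smul]
      exact Set.add_mem_add (ih fun j => hx _) (hx _)
  have h : (r : ℝ) = k + (r - k) := by ring
  rw [h, hK.add_smul k.cast_nonneg (sub_nonneg.2 (by exact_mod_cast hkr)),
    ← add_zero (∑ j, x j)]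
  exact Set.add_mem_add hsum ⟨0, h0, smul_zero _⟩

/-- A rank-`r` tensor of order `d + 1` with entries in `[-α, α]` lies in `r ^ d * α` times the
convex hull of the sign tensors. Inductively, it is a combination of at most `r` of its slices
with coefficients in `[-1, 1]`, and the slices again have rank at most `r`. -/
theorem mem_smul_convexHull_signTensors {N r : ℕ} {α : ℝ} (hα : 0 < α) (d : ℕ)
    (T : TIndex N (d + 1) → ℝ) (hrank : HasRankAtMost T r) (hT : ∀ ω, |T ω| ≤ α) :
    T ∈ ((r : ℝ) ^ d * α) • convexHull ℝ (signTensors N (d + 1)) := by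
  induction d with
  | zero =>
    rw [pow_zero, one_mul, Set.mem_smul_set_iff_inv_smul_mem₀ hα.ne']
    refine mem_convexHull_signTensors_one fun ω => ?_
    rw [Pi.smul_apply, smul_eq_mul, abs_mul, abs_inv, abs_of_pos hα]
    exact inv_mul_le_one_of_le₀ (hT ω) hα.le
  | succ d ih =>
    obtain ⟨u, hu⟩ := hrank
    obtain ⟨k, hk, s, c, hc, hsum⟩ := exists_bounded_coeff fun n (i : Fin r) => u i 0 n
    rw [Module.finrank_fin_fun] at hk
    have hslice (j : Fin k) : ∃ S ∈ convexHull ℝ (signTensors N (d + 1)),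
        ((r : ℝ) ^ d * α) • S = fun ω => T (Fin.cons (s j) ω) := by
      refine ih _ ⟨fun i l n => Fin.cases (u i 0 (s j) * u i 1 n) (fun l => u i l.succ.succ n) l,
        fun ω => ?_⟩ fun ω => hT _
      simp [hu, Fin.prod_univ_succ, mul_assoc]
    choose S hS hST using hslice
    have hdecomp : T = ((r : ℝ) ^ d * α) •
        ∑ j, fun ω : TIndex N (d + 2) => c (ω 0) j * S j (Fin.tail ω) := by
      ext ω
      have hSω (j : Fin k) : (r : ℝ) ^ d * α * S j (Fin.tail ω) =
          ∑ i, u i 0 (s j) * ∏ l : Fin (d + 1), u i l.succ (ω l.succ) := by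
        have := congrFun (hST j) (Fin.tail ω)
        simp only [Pi.smul_apply, smul_eq_mul] at this
        rw [this, hu]
        simp [Fin.prod_univ_succ (n := d + 1), Fin.tail]
      have hu0 (i : Fin r) : u i 0 (ω 0) = ∑ j, c (ω 0) j * u i 0 (s j) := by
        simpa using congrFun (hsum (ω 0)) i
      simp only [Pi.smul_apply, smul_eq_mul, Finset.sum_apply, Finset.mul_sum]
      simp only [mul_left_comm _ (c _ _), hSω]
      rw [hu]
      simp only [Fin.prod_univ_succ (n := d + 1), hu0, Finset.sum_mul, Finset.mul_sum]
      rw [Finset.sum_comm]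
      simp only [mul_assoc]
    rw [hdecomp, pow_succ, mul_right_comm, mul_smul]
    exact Set.smul_mem_smul_set ((convex_convexHull ℝ _).sum_mem_natCast_smul
      (zero_mem_convexHull_signTensors N (d + 1)) hk
      fun j => outer_mem_convexHull_signTensors (fun i => hc i j) (hS j))

/-- M-norm bounds for a bounded rank-`r` tensor. -/
theorem Mnorm_rank_bounds (N d r : ℕ) (hd : 2 ≤ d) (hN : 1 ≤ N)
    (T : TIndex N d → ℝ) (hT : T ≠ 0) (hrank : HasRankAtMost T r)
    (α : ℝ) (hα : infNorm T = α) :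
    α ≤ Mnorm T ∧ Mnorm T ≤ ((r : ℝ) * Real.sqrt r) ^ (d - 1) * α := by
  have hle (ω : TIndex N d) : |T ω| ≤ α :=
    hα ▸ le_csSup (Set.finite_range _).bddAbove ⟨ω, rfl⟩
  obtain ⟨ω₀, hω₀⟩ := Function.ne_iff.1 hT
  have hαpos : 0 < α := (abs_pos.2 hω₀).trans_le (hle ω₀)
  have hr : (1 : ℝ) ≤ r := by
    rw [Nat.one_le_cast, Nat.one_le_iff_ne_zero]
    rintro rfl
    obtain ⟨u, hu⟩ := hrank
    exact hω₀ (by simp [hu])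
  obtain ⟨d, rfl⟩ : ∃ e, d = e + 1 := ⟨d - 1, by omega⟩
  have hmem : (r : ℝ) ^ d * α ∈
      {t : ℝ | 0 < t ∧ T ∈ t • convexHull ℝ (signTensors N (d + 1))} :=
    ⟨by positivity, mem_smul_convexHull_signTensors hαpos d T hrank hle⟩
  constructor
  · refine le_csInf ⟨_, hmem⟩ ?_
    rintro t ⟨ht, S, hS, rfl⟩
    have : Nonempty (TIndex N (d + 1)) := ⟨ω₀⟩
    rw [← hα]
    refine csSup_le (Set.range_nonempty _) ?_
    rintro _ ⟨ω, rfl⟩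
    simp only [Pi.smul_apply, smul_eq_mul, abs_mul, abs_of_pos ht]
    exact mul_le_of_le_one_right ht.le (abs_le_one_of_mem_convexHull_signTensors hS ω)
  · refine (csInf_le ⟨0, fun t ht => ht.1.le⟩ hmem).trans ?_
    rw [Nat.add_sub_cancel]
    gcongr
    exact le_mul_of_one_le_right (by positivity) (Real.one_le_sqrt.2 hr)

end
end

section
/- Let d ≥ 2, N ≥ 1, and let T be a nonzero order-d tensor of size N with rank at most r and ‖T‖_∞ = α. Then α ≤ ‖T‖_max ≤ √(r^{d²−d}) · α. -/
open scoped BigOperators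
open Classical MeasureTheory Pointwise

noncomputable section

/-- A finite spanning family contains a basis in which all its members have coordinates of
absolute value at most one: take the members maximizing a determinant. -/
lemma exists_bounded_coordinates_of_span_eq_top {ι V : Type*} [Finite ι] [Nonempty ι]
    [AddCommGroup V] [Module ℝ V] [FiniteDimensional ℝ V] (v : ι → V)
    (hv : Submodule.span ℝ (Set.range v) = ⊤) :
    ∃ (a : Fin (Module.finrank ℝ V) → ι) (A : ι → Fin (Module.finrank ℝ V) → ℝ),
      (∀ x i, |A x i| ≤ 1) ∧ ∀ x, v x = ∑ i, A x i • v (a i) := by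
  obtain ⟨κ, a₀, -, hspan, hli⟩ := exists_linearIndependent' ℝ v
  let b₀ := Module.Basis.mk hli (by rw [hspan, hv])
  let e : κ ≃ Fin (Module.finrank ℝ V) :=
    b₀.indexEquiv (Module.finBasis ℝ V)
  let b := b₀.reindex e
  have hb : ⇑b = v ∘ (a₀ ∘ e.symm) := by
    ext i; simp [b, b₀]
  obtain ⟨a, ha⟩ := Finite.exists_max fun a : Fin (Module.finrank ℝ V) → ι => |b.det (v ∘ a)|
  have hdet : 0 < |b.det (v ∘ a)| := by
    refine lt_of_lt_of_le ?_ (ha (a₀ ∘ e.symm))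
    rw [← hb, b.det_self]; simp
  obtain ⟨hli', hspan'⟩ := b.is_basis_iff_det.2 (isUnit_iff_ne_zero.2 (abs_pos.1 hdet))
  let b' := Module.Basis.mk hli' hspan'.ge
  have hb' : ⇑b' = v ∘ a := by simp [b']
  refine ⟨a, fun x => b'.repr (v x), fun x i => ?_, fun x => ?_⟩
  · have hcoord : b'.det (Function.update (v ∘ a) i (v x)) = b'.repr (v x) i := by
      rw [← hb', Module.Basis.det_apply, Module.Basis.toMatrix_update, Module.Basis.toMatrix_self,
        ← Matrix.cramer_apply, Matrix.cramer_one]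
      rfl
    have hscale : b.det (Function.update (v ∘ a) i (v x))
        = b.det (v ∘ a) * b'.repr (v x) i := by
      rw [AlternatingMap.eq_smul_basis_det b' b.det, AlternatingMap.smul_apply, hcoord, hb',
        AlternatingMap.smul_apply, ← hb', b'.det_self]
      simp
    have hmax := ha (Function.update a i x)
    rw [Function.comp_update, hscale, abs_mul] at hmax
    exact le_of_mul_le_mul_left (by linarith) hdet
  · conv_lhs => rw [← b'.sum_repr (v x)]
    simp [hb']

/-- Every row of a matrix with `r` columns is a combination, with coefficients in `[-1, 1]`, of
`r` of its rows. -/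
lemma exists_bounded_row_combination {ι : Type*} [Finite ι] [Nonempty ι] {r : ℕ}
    (P : ι → Fin r → ℝ) :
    ∃ (a : Fin r → ι) (A : ι → Fin r → ℝ),
      (∀ x i, |A x i| ≤ 1) ∧ ∀ x c, P x c = ∑ i, A x i * P (a i) c := by
  let W := Submodule.span ℝ (Set.range P)
  let v : ι → W := fun x => ⟨P x, Submodule.subset_span ⟨x, rfl⟩⟩
  have hv : Submodule.span ℝ (Set.range v) = ⊤ := by
    convert Submodule.span_span_coe_preimage (R := ℝ) (s := Set.range P) using 2
    ext y
    simp [v, Subtype.ext_iff]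
  obtain ⟨a, A, hA, hrepr⟩ := exists_bounded_coordinates_of_span_eq_top v hv
  have hle : Module.finrank ℝ W ≤ r := by simpa using Submodule.finrank_le W
  have hinj := Fin.castLE_injective hle
  refine ⟨Function.extend (Fin.castLE hle) a fun _ => Classical.arbitrary ι,
    fun x => Function.extend (Fin.castLE hle) (A x) 0, fun x i => ?_, fun x c => ?_⟩
  · by_cases h : ∃ k, Fin.castLE hle k = i
    · obtain ⟨k, rfl⟩ := h
      simpa [hinj.extend_apply] using hA x k
    · simp [Function.extend_apply' _ _ _ h]
  · have h : P x c = ∑ i, A x i * P (a i) c := by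
      simpa [v] using congrFun (congrArg Subtype.val (hrepr x)) c
    rw [h]
    refine Finset.sum_of_injOn (Fin.castLE hle) hinj.injOn (by simp) (fun i _ hi => ?_)
      fun k _ => by simp [hinj.extend_apply]
    have h_not : ¬∃ k, Fin.castLE hle k = i := fun ⟨k, hk⟩ => hi ⟨k, by simp, hk⟩
    simp [Function.extend_apply' _ _ _ h_not]

/-- A tensor of order `e + 1` and rank at most `r` is a sum of `r ^ e` rank-one tensors, indexed by
`Fin e → Fin r`, whose first `e` modes have entries in `[-1, 1]` and whose last mode is a fiber. -/
lemma HasRankAtMost.exists_fiber_decomposition {N e r : ℕ} (hN : 1 ≤ N)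
    {T : TIndex N (e + 1) → ℝ} (hT : HasRankAtMost T r) :
    ∃ (a : Fin e → Fin r → Fin N) (A : Fin e → Fin N → Fin r → ℝ),
      (∀ j x i, |A j x i| ≤ 1) ∧ ∀ ω, T ω = ∑ c : Fin e → Fin r,
        T (Fin.cons (ω 0) fun j => a j (c j)) * ∏ j, A j (ω j.succ) (c j) := by
  obtain ⟨u, hu⟩ := hT
  have : Nonempty (Fin N) := ⟨⟨0, hN⟩⟩
  choose a A hA hrepr using fun j : Fin e =>
    exists_bounded_row_combination fun (x : Fin N) (i : Fin r) => u i j.succ x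
  refine ⟨a, A, hA, fun ω => ?_⟩
  simp_rw [hu, Fin.prod_univ_succ, Fin.cons_zero, Fin.cons_succ]
  have hexpand (i : Fin r) : ∏ j : Fin e, u i j.succ (ω j.succ)
      = ∑ c : Fin e → Fin r, ∏ j, A j (ω j.succ) (c j) * u i j.succ (a j (c j)) := by
    simp_rw [fun j : Fin e => hrepr j (ω j.succ) i, Fintype.prod_sum]
  simp_rw [hexpand, Finset.mul_sum, Finset.sum_mul]
  rw [Finset.sum_comm]
  refine Finset.sum_congr rfl fun c _ => Finset.sum_congr rfl fun i _ => ?_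
  rw [Finset.prod_mul_distrib]
  ring

lemma abs_le_infNorm {N d : ℕ} (T : TIndex N d → ℝ) (ω : TIndex N d) : |T ω| ≤ infNorm T :=
  le_csSup (Set.finite_range _).bddAbove ⟨ω, rfl⟩

lemma sqrt_sum_sq_le_rowNorm {N k : ℕ} (U : Fin N → Fin k → ℝ) (x : Fin N) :
    Real.sqrt (∑ c, (U x c) ^ 2) ≤ rowNorm U :=
  le_csSup (Set.finite_range _).bddAbove ⟨x, rfl⟩

lemma rowNorm_nonneg {N k : ℕ} (U : Fin N → Fin k → ℝ) : 0 ≤ rowNorm U :=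
  Real.sSup_nonneg (by rintro _ ⟨x, rfl⟩; exact Real.sqrt_nonneg _)

lemma rowNorm_le_sqrt_card_mul {N k : ℕ} (U : Fin N → Fin k → ℝ) {M : ℝ}
    (hM : 0 ≤ M) (hU : ∀ x c, |U x c| ≤ M) : rowNorm U ≤ Real.sqrt k * M := by
  refine Real.sSup_le ?_ (by positivity)
  rintro _ ⟨x, rfl⟩
  refine Real.sqrt_le_iff.2 ⟨by positivity, ?_⟩
  calc ∑ c, (U x c) ^ 2 ≤ ∑ _c : Fin k, M ^ 2 :=
        Finset.sum_le_sum fun c _ => sq_le_sq' (abs_le.1 (hU x c)).1 (abs_le.1 (hU x c)).2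
    _ = (Real.sqrt k * M) ^ 2 := by
        rw [mul_pow, Real.sq_sqrt (Nat.cast_nonneg k)]; simp

/-- Hölder's inequality for a product of at least two vectors, all measured in `ℓ₂`. -/
lemma sum_prod_abs_le_prod_sqrt {κ : Type*} [Fintype κ] {d : ℕ} (hd : 2 ≤ d)
    (f : Fin d → κ → ℝ) :
    ∑ c, ∏ j, |f j c| ≤ ∏ j, Real.sqrt (∑ c, (f j c) ^ 2) := by
  obtain ⟨e, rfl⟩ := Nat.exists_eq_add_of_le' hd
  simp_rw [Fin.prod_univ_succ, ← mul_assoc]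
  have hentry (j : Fin (e + 2)) (c : κ) : |f j c| ≤ Real.sqrt (∑ c, (f j c) ^ 2) := by
    rw [← Real.sqrt_sq_eq_abs]
    exact Real.sqrt_le_sqrt
      (Finset.single_le_sum (f := fun c => (f j c) ^ 2) (fun _ _ => sq_nonneg _)
        (Finset.mem_univ c))
  calc _ ≤ ∑ c, |f 0 c| * |f (Fin.succ 0) c|
          * ∏ j : Fin e, Real.sqrt (∑ c, (f j.succ.succ c) ^ 2) := by
        refine Finset.sum_le_sum fun c _ => mul_le_mul_of_nonneg_left ?_ (by positivity)
        exact Finset.prod_le_prod (fun _ _ => abs_nonneg _) fun j _ => hentry _ c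
    _ ≤ _ := by
        rw [← Finset.sum_mul]
        refine mul_le_mul_of_nonneg_right ?_ (by positivity)
        simpa using Real.sum_mul_le_sqrt_mul_sqrt Finset.univ
          (fun c => |f 0 c|) fun c => |f (Fin.succ 0) c|

lemma infNorm_le_prod_rowNorm {N d k : ℕ} (hd : 2 ≤ d) {T : TIndex N d → ℝ}
    {U : Fin d → Fin N → Fin k → ℝ} (hU : ∀ ω, T ω = ∑ c, ∏ j, U j (ω j) c) :
    infNorm T ≤ ∏ j, rowNorm (U j) := by
  refine Real.sSup_le ?_ (Finset.prod_nonneg fun j _ => rowNorm_nonneg _)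
  rintro _ ⟨ω, rfl⟩
  calc |T ω| ≤ ∑ c, ∏ j, |U j (ω j) c| := by
        rw [hU]
        exact (Finset.abs_sum_le_sum_abs _ _).trans_eq (by simp_rw [Finset.abs_prod])
    _ ≤ ∏ j, Real.sqrt (∑ c, (U j (ω j) c) ^ 2) :=
        sum_prod_abs_le_prod_sqrt hd fun j => U j (ω j)
    _ ≤ _ := Finset.prod_le_prod (fun _ _ => Real.sqrt_nonneg _)
        fun j _ => sqrt_sum_sq_le_rowNorm _ _

lemma HasRankAtMost.exists_factorization_prod_rowNorm_le {N d r : ℕ} (hd : 1 ≤ d) (hN : 1 ≤ N)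
    {T : TIndex N d → ℝ} (hT : HasRankAtMost T r) :
    ∃ (k : ℕ) (U : Fin d → Fin N → Fin k → ℝ), (∀ ω, T ω = ∑ c, ∏ j, U j (ω j) c) ∧
      ∏ j, rowNorm (U j) ≤ Real.sqrt ((r : ℝ) ^ (d ^ 2 - d)) * infNorm T := by
  obtain ⟨e, rfl⟩ := Nat.exists_eq_add_of_le' hd
  obtain ⟨a, A, hA, hdecomp⟩ := hT.exists_fiber_decomposition hN
  let φ : (Fin e → Fin r) ≃ Fin (r ^ e) := finFunctionFinEquiv
  let U : Fin (e + 1) → Fin N → Fin (r ^ e) → ℝ := Fin.cons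
    (fun x c => T (Fin.cons x fun j => a j (φ.symm c j)))
    fun j x c => A j x (φ.symm c j)
  have hinf : 0 ≤ infNorm T := (abs_nonneg _).trans (abs_le_infNorm T fun _ => ⟨0, hN⟩)
  refine ⟨r ^ e, U, fun ω => ?_, ?_⟩
  · rw [hdecomp, ← φ.symm.sum_comp]
    simp [U, Fin.prod_univ_succ]
  · rw [Fin.prod_univ_succ]
    calc _ ≤ (Real.sqrt (r ^ e : ℕ) * infNorm T) * ∏ _j : Fin e, (Real.sqrt (r ^ e : ℕ) * 1) :=
          mul_le_mul
            (rowNorm_le_sqrt_card_mul _ hinf fun x c => abs_le_infNorm T _)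
            (Finset.prod_le_prod (fun _ _ => rowNorm_nonneg _) fun j _ =>
              rowNorm_le_sqrt_card_mul _ zero_le_one fun x c => hA j x _)
            (Finset.prod_nonneg fun _ _ => rowNorm_nonneg _) (by positivity)
      _ = Real.sqrt ((r ^ e : ℕ) : ℝ) ^ (e + 1) * infNorm T := by
          simp [pow_succ]; ring
      _ = Real.sqrt ((r : ℝ) ^ ((e + 1) ^ 2 - (e + 1))) * infNorm T := by
          have hexp : (e + 1) ^ 2 - (e + 1) = e * (e + 1) := by
            rw [Nat.sub_eq_iff_eq_add (by nlinarith)]; ring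
          have hsqrt : Real.sqrt (((r : ℝ) ^ e) ^ (e + 1)) = Real.sqrt ((r : ℝ) ^ e) ^ (e + 1) := by
            rw [Real.sqrt_eq_iff_mul_self_eq (by positivity) (by positivity), ← mul_pow,
              Real.mul_self_sqrt (by positivity)]
          rw [hexp, pow_mul, Nat.cast_pow, hsqrt]

/-- max-qnorm bounds for a bounded rank-`r` tensor. -/
theorem maxQnorm_rank_bounds (N d r : ℕ) (hd : 2 ≤ d) (hN : 1 ≤ N)
    (T : TIndex N d → ℝ) (hT : T ≠ 0) (hrank : HasRankAtMost T r)
    (α : ℝ) (hα : infNorm T = α) :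
    α ≤ maxQnorm T ∧ maxQnorm T ≤ Real.sqrt ((r : ℝ) ^ (d ^ 2 - d)) * α := by
  subst hα
  obtain ⟨k, U, hU, hle⟩ := hrank.exists_factorization_prod_rowNorm_le (by omega) hN
  have hlower : infNorm T ∈ lowerBounds {t : ℝ | ∃ (k : ℕ) (U : Fin d → Fin N → Fin k → ℝ),
      (∀ ω : TIndex N d, T ω = ∑ c : Fin k, ∏ j : Fin d, U j (ω j) c) ∧
      t = ∏ j : Fin d, rowNorm (U j)} := by
    rintro _ ⟨k, U, hU, rfl⟩
    exact infNorm_le_prod_rowNorm hd hU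
  exact ⟨le_csInf ⟨_, k, U, hU, rfl⟩ hlower, (csInf_le ⟨_, hlower⟩ ⟨k, U, hU, rfl⟩).trans hle⟩

end
end
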